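/- Let n ≥ 2, m ≥ 0, c > 0, and f ∈ C_c^∞(ℝ^{1+n}; S^m). Suppose L̃^{m,m} f((t,x), ω) = 0 for all ω ∈ S^{n−1} and all (t,x) ∈ ℝ^{1+n}. Then: if m ≥ 2 there exists f^{(m−2)} ∈ C_c^∞(ℝ^{1+n}; S^{m−2}) such that f = i_{g_{1/c}} f^{(m−2)}, and if m ∈ {0,1} then f = 0. -/

import Mathlib

open MeasureTheory Finset

noncomputable section

/-- The light direction `ω̃ = (c, ω) ∈ ℝ^{1+n}`. -/
def ld (n : ℕ) (c : ℝ) (ω : Fin n → ℝ) : Fin (n + 1) → ℝ := Fin.cons c ω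

/-- The `k`-th momentum light ray transform of a rank-`m` symmetric tensor field,
`L^{m,k} f((t,x), ω) = Σ ω̃_{i_1}⋯ω̃_{i_m} ∫ s^k f_{i_1…i_m}((t,x) + s ω̃) ds`. -/
def mlrt (n m : ℕ) (c : ℝ) (k : ℕ)
    (f : (Fin m → Fin (n + 1)) → (Fin (n + 1) → ℝ) → ℂ)
    (x : Fin (n + 1) → ℝ) (ω : Fin n → ℝ) : ℂ :=
  ∑ i : Fin m → Fin (n + 1),
    (∏ j, (ld n c ω (i j) : ℂ)) *
      ∫ s : ℝ, (s : ℂ) ^ k * f i (x + s • ld n c ω)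

/-- A tensor field is symmetric: invariant under permutations of its indices. -/
def IsSymmF (n m : ℕ) (f : (Fin m → Fin (n + 1)) → (Fin (n + 1) → ℝ) → ℂ) : Prop :=
  ∀ (σ : Equiv.Perm (Fin m)) (i : Fin m → Fin (n + 1)), f (i ∘ σ) = f i

/-- All components are smooth and compactly supported. -/
def IsCc (n m : ℕ) (f : (Fin m → Fin (n + 1)) → (Fin (n + 1) → ℝ) → ℂ) : Prop :=
  ∀ i, ContDiff ℝ (⊤ : ℕ∞) (f i) ∧ HasCompactSupport (f i)

/-- `ω ∈ S^{n-1}` (Euclidean unit sphere). -/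
def onSphere (n : ℕ) (ω : Fin n → ℝ) : Prop := ∑ i, ω i ^ 2 = 1

/-- `ω ∈ B_n(ω₀, δ)`: on the sphere and at Euclidean distance `< δ` from `ω₀`. -/
def inBall (n : ℕ) (ω₀ : Fin n → ℝ) (δ : ℝ) (ω : Fin n → ℝ) : Prop :=
  onSphere n ω ∧ ∑ i, (ω i - ω₀ i) ^ 2 < δ ^ 2

/-- The constant symmetric 2-tensor `g_{1/c} = diag(−1/c², 1, …, 1)`. -/
def gmet (n : ℕ) (c : ℝ) : Fin (n + 1) → Fin (n + 1) → ℝ :=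
  fun i j => if i = j then (if i = 0 then -(1 / c ^ 2) else 1) else 0

/-- `(i_v u)_{i_1…i_{m+2}} = (1/(m+2)!) Σ_{π} u_{i_{π(1)}…i_{π(m)}} v_{i_{π(m+1)} i_{π(m+2)}}`,
for a tensor field `u` of rank `m`. -/
def iOpF (n m : ℕ) (v : Fin (n + 1) → Fin (n + 1) → ℝ)
    (u : (Fin m → Fin (n + 1)) → (Fin (n + 1) → ℝ) → ℂ)
    (i : Fin (m + 2) → Fin (n + 1)) (x : Fin (n + 1) → ℝ) : ℂ :=
  ((m + 2).factorial : ℂ)⁻¹ *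
    ∑ π : Equiv.Perm (Fin (m + 2)),
      u (fun j => i (π (Fin.castLE (Nat.le_add_right m 2) j))) x *
        (v (i (π ⟨m, by omega⟩)) (i (π ⟨m + 1, by omega⟩)) : ℂ)

/-- exponent vector of an index tuple -/
def tty {n m : ℕ} (i : Fin m → Fin (n + 1)) : Fin (n + 1) →₀ ℕ := ∑ j, Finsupp.single (i j) 1

/-- polynomial of a tensor -/
def tpol {n m : ℕ} (t : (Fin m → Fin (n + 1)) → ℂ) : MvPolynomial (Fin (n + 1)) ℂ :=
  ∑ i, MvPolynomial.C (t i) * ∏ j, MvPolynomial.X (i j)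

theorem prod_X_eq {n m : ℕ} (i : Fin m → Fin (n + 1)) :
    (∏ j, MvPolynomial.X (i j) : MvPolynomial (Fin (n + 1)) ℂ) = MvPolynomial.monomial (tty i) 1 := by
  simp only [tty, MvPolynomial.X]
  exact (MvPolynomial.monomial_sum_one univ (fun j => Finsupp.single (i j) 1)).symm

theorem coeff_tpol {n m : ℕ} (t : (Fin m → Fin (n + 1)) → ℂ) (μ : Fin (n + 1) →₀ ℕ) :
    (tpol t).coeff μ = ∑ i, if tty i = μ then t i else 0 := by
  simp [tpol, prod_X_eq, MvPolynomial.coeff_sum, MvPolynomial.coeff_C_mul,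
    MvPolynomial.coeff_monomial]

theorem tty_apply {n m : ℕ} (i : Fin m → Fin (n + 1)) (a : Fin (n + 1)) :
    tty i a = Fintype.card {j // i j = a} := by
  simp [tty, Finsupp.finsetSum_apply, Finsupp.single_apply, Fintype.card_subtype]

theorem tty_perm {n m : ℕ} {i k : Fin m → Fin (n + 1)} (h : tty i = tty k) :
    ∃ σ : Equiv.Perm (Fin m), i = k ∘ σ := by
  have h1 : ∀ a, Nonempty ({j // i j = a} ≃ {j // k j = a}) := fun a => by
    rw [← Fintype.card_eq, ← tty_apply, ← tty_apply, h]
  refine ⟨Equiv.ofFiberEquiv fun a => (h1 a).some, ?_⟩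
  funext j
  exact (Equiv.ofFiberEquiv_map _ j).symm

theorem tty_comp {n m : ℕ} (i : Fin m → Fin (n + 1)) (σ : Equiv.Perm (Fin m)) :
    tty (i ∘ σ) = tty i := by
  unfold tty
  exact Equiv.sum_comp σ (fun j => Finsupp.single (i j) 1)

/-- pointwise symmetry -/
def TSym {n m : ℕ} (t : (Fin m → Fin (n + 1)) → ℂ) : Prop :=
  ∀ (σ : Equiv.Perm (Fin m)) i, t (i ∘ σ) = t i

theorem tpol_inj {n m : ℕ} {t t' : (Fin m → Fin (n + 1)) → ℂ} (ht : TSym t) (ht' : TSym t')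
    (h : tpol t = tpol t') : t = t' := by
  funext i
  have h1 := congrArg (MvPolynomial.coeff (tty i)) h
  rw [coeff_tpol, coeff_tpol] at h1
  have key : ∀ s : (Fin m → Fin (n + 1)) → ℂ, TSym s →
      (∑ k, if tty k = tty i then s k else 0) =
        ((univ.filter fun k : Fin m → Fin (n + 1) => tty k = tty i).card : ℂ) * s i := by
    intro s hs
    rw [← Finset.sum_filter, ← nsmul_eq_mul]
    apply Finset.sum_eq_card_nsmul
    intro k hk
    obtain ⟨σ, rfl⟩ := tty_perm (Finset.mem_filter.1 hk).2
    exact hs σ i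
  rw [key t ht, key t' ht'] at h1
  refine mul_left_cancel₀ ?_ h1
  exact_mod_cast (Finset.card_pos.2 ⟨i, by simp⟩).ne'

theorem tty_surj {n m : ℕ} (μ : Fin (n + 1) →₀ ℕ) (h : μ.degree = m) :
    ∃ i : Fin m → Fin (n + 1), tty i = μ := by
  induction m generalizing μ with
  | zero =>
    refine ⟨Fin.elim0, ?_⟩
    rw [Finsupp.degree_eq_zero_iff] at h
    simp [tty, h]
  | succ m ih =>
    have hne : μ ≠ 0 := by rintro rfl; simp at h
    obtain ⟨a, ha⟩ := Finsupp.ne_iff.1 hne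
    have hle : Finsupp.single a 1 ≤ μ := by
      rw [Finsupp.single_le_iff]; exact Nat.one_le_iff_ne_zero.2 (by simpa using ha)
    obtain ⟨ν, rfl⟩ := exists_add_of_le hle
    have hν : ν.degree = m := by
      simp at h; omega
    obtain ⟨i, hi⟩ := ih ν hν
    refine ⟨Fin.cons a i, ?_⟩
    simp [tty, Fin.sum_univ_succ, ← hi]

theorem tpol_surj {n m : ℕ} {q : MvPolynomial (Fin (n + 1)) ℂ} (hq : q.IsHomogeneous m) :
    ∃ u : (Fin m → Fin (n + 1)) → ℂ, TSym u ∧ tpol u = q := by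
  refine ⟨fun i => q.coeff (tty i) /
    ((univ.filter fun k : Fin m → Fin (n + 1) => tty k = tty i).card : ℂ), ?_, ?_⟩
  · intro σ i
    simp only [tty_comp]
  · ext μ
    rw [coeff_tpol, ← Finset.sum_filter]
    by_cases hμ : ∃ i : Fin m → Fin (n + 1), tty i = μ
    · obtain ⟨i, rfl⟩ := hμ
      have : ((univ.filter fun k : Fin m → Fin (n + 1) => tty k = tty i).card : ℂ) ≠ 0 := by
        exact_mod_cast (Finset.card_pos.2 ⟨i, by simp⟩).ne'
      rw [Finset.sum_eq_card_nsmul (b := q.coeff (tty i) /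
        ((univ.filter fun k : Fin m → Fin (n + 1) => tty k = tty i).card : ℂ))]
      · rw [nsmul_eq_mul]; field_simp
      · intro k hk
        rw [(Finset.mem_filter.1 hk).2]
    · have h1 : (univ.filter fun k : Fin m → Fin (n + 1) => tty k = μ) = ∅ := by
        ext k; simp; exact fun h => hμ ⟨k, h⟩
      rw [h1, Finset.sum_empty]
      symm
      by_contra hne
      apply hμ
      apply tty_surj
      have := hq hne
      rwa [Finsupp.degree_eq_weight_one]

theorem tpol_homog {n m : ℕ} (t : (Fin m → Fin (n + 1)) → ℂ) : (tpol t).IsHomogeneous m := by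
  apply MvPolynomial.IsHomogeneous.sum
  intro i _
  have h1 : (∏ j, MvPolynomial.X (i j) : MvPolynomial (Fin (n + 1)) ℂ).IsHomogeneous
      (∑ j : Fin m, 1) :=
    MvPolynomial.IsHomogeneous.prod _ _ _ fun j _ => MvPolynomial.isHomogeneous_X _ _
  have := (MvPolynomial.isHomogeneous_C (Fin (n + 1)) (t i)).mul h1
  simpa using this

theorem eval_tpol {n m : ℕ} (t : (Fin m → Fin (n + 1)) → ℂ) (v : Fin (n + 1) → ℂ) :
    MvPolynomial.eval v (tpol t) = ∑ i, t i * ∏ j, v (i j) := by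
  simp [tpol]

/-- pointwise version of `iOpF` -/
def iOpT (n m : ℕ) (v : Fin (n + 1) → Fin (n + 1) → ℝ)
    (u : (Fin m → Fin (n + 1)) → ℂ)
    (i : Fin (m + 2) → Fin (n + 1)) : ℂ :=
  ((m + 2).factorial : ℂ)⁻¹ *
    ∑ π : Equiv.Perm (Fin (m + 2)),
      u (fun j => i (π (Fin.castLE (Nat.le_add_right m 2) j))) *
        (v (i (π ⟨m, by omega⟩)) (i (π ⟨m + 1, by omega⟩)) : ℂ)

theorem iOpT_sym {n m : ℕ} (v : Fin (n + 1) → Fin (n + 1) → ℝ)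
    (u : (Fin m → Fin (n + 1)) → ℂ) : TSym (iOpT n m v u) := by
  intro σ i
  unfold iOpT
  congr 1
  exact Equiv.sum_comp (Equiv.mulLeft σ) (fun π : Equiv.Perm (Fin (m + 2)) =>
      u (fun j => i (π (Fin.castLE (Nat.le_add_right m 2) j))) *
        (v (i (π ⟨m, by omega⟩)) (i (π ⟨m + 1, by omega⟩)) : ℂ))

/-- quadratic form as polynomial -/
def qpol (n : ℕ) (c : ℝ) : MvPolynomial (Fin (n + 1)) ℂ :=
  ∑ a, ∑ b, MvPolynomial.C (gmet n c a b : ℂ) * (MvPolynomial.X a * MvPolynomial.X b)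

theorem tpol_iOpT {n m : ℕ} (c : ℝ) (u : (Fin m → Fin (n + 1)) → ℂ) :
    tpol (iOpT n m (gmet n c) u) = qpol n c * tpol u := by
  have step1 : tpol (iOpT n m (gmet n c) u) =
      ∑ i : Fin (m + 2) → Fin (n + 1),
        MvPolynomial.C (u (fun j => i (Fin.castLE (Nat.le_add_right m 2) j)) *
        (gmet n c (i ⟨m, by omega⟩) (i ⟨m + 1, by omega⟩) : ℂ)) * ∏ j, MvPolynomial.X (i j) := by
    unfold tpol iOpT
    have : ∀ i : Fin (m + 2) → Fin (n + 1), (MvPolynomial.C (((m + 2).factorial : ℂ)⁻¹ *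
        ∑ π : Equiv.Perm (Fin (m + 2)),
        u (fun j => i (π (Fin.castLE (Nat.le_add_right m 2) j))) *
        (gmet n c (i (π ⟨m, by omega⟩)) (i (π ⟨m + 1, by omega⟩)) : ℂ)) *
          ∏ j, MvPolynomial.X (i j) : MvPolynomial (Fin (n + 1)) ℂ) =
        MvPolynomial.C (((m + 2).factorial : ℂ)⁻¹) * ∑ π : Equiv.Perm (Fin (m + 2)),
        MvPolynomial.C (u (fun j => i (π (Fin.castLE (Nat.le_add_right m 2) j))) *
        (gmet n c (i (π ⟨m, by omega⟩)) (i (π ⟨m + 1, by omega⟩)) : ℂ)) *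
          ∏ j, MvPolynomial.X (i j) := by
      intro i
      rw [MvPolynomial.C_mul, map_sum, mul_assoc, Finset.sum_mul]
    rw [Finset.sum_congr rfl fun i _ => this i, ← Finset.mul_sum, Finset.sum_comm]
    have h2 : ∀ π : Equiv.Perm (Fin (m + 2)),
        (∑ i : Fin (m + 2) → Fin (n + 1),
        MvPolynomial.C (u (fun j => i (π (Fin.castLE (Nat.le_add_right m 2) j))) *
        (gmet n c (i (π ⟨m, by omega⟩)) (i (π ⟨m + 1, by omega⟩)) : ℂ)) *
          ∏ j, MvPolynomial.X (i j) : MvPolynomial (Fin (n + 1)) ℂ) =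
        ∑ i : Fin (m + 2) → Fin (n + 1),
        MvPolynomial.C (u (fun j => i (Fin.castLE (Nat.le_add_right m 2) j)) *
        (gmet n c (i ⟨m, by omega⟩) (i ⟨m + 1, by omega⟩) : ℂ)) * ∏ j, MvPolynomial.X (i j) := by
      intro π
      rw [← Equiv.sum_comp (Equiv.arrowCongr π (Equiv.refl (Fin (n + 1))))]
      refine Finset.sum_congr rfl fun i _ => ?_
      simp only [Equiv.arrowCongr_apply, Function.comp_apply, Equiv.coe_refl, id_eq,
        Equiv.symm_apply_apply]
      congr 1
      exact Equiv.prod_comp π.symm (fun j => (MvPolynomial.X (i j) : MvPolynomial (Fin (n + 1)) ℂ))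
    rw [Finset.sum_congr rfl fun π _ => h2 π, Finset.sum_const, Finset.card_univ,
      Fintype.card_perm, Fintype.card_fin, nsmul_eq_mul, ← mul_assoc]
    have h3 : (MvPolynomial.C (((m + 2).factorial : ℂ)⁻¹) * ((m + 2).factorial :
        MvPolynomial (Fin (n + 1)) ℂ)) = 1 := by
      rw [← map_natCast (MvPolynomial.C (σ := Fin (n + 1)) (R := ℂ)), ← MvPolynomial.C_mul,
        inv_mul_cancel₀ (by exact_mod_cast Nat.factorial_ne_zero _), MvPolynomial.C_1]
    rw [h3, one_mul]
  rw [step1]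
  rw [← Equiv.sum_comp (Fin.snocEquiv (fun _ : Fin (m + 2) => Fin (n + 1))), Fintype.sum_prod_type,
    Finset.sum_comm,
    ← Equiv.sum_comp (Fin.snocEquiv (fun _ : Fin (m + 1) => Fin (n + 1))), Fintype.sum_prod_type,
    qpol, Finset.sum_mul]
  refine Finset.sum_congr rfl fun a _ => ?_
  rw [Finset.sum_comm, Finset.sum_mul]
  refine Finset.sum_congr rfl fun b _ => ?_
  rw [tpol, Finset.mul_sum]
  refine Finset.sum_congr rfl fun i _ => ?_
  have e1 : (⟨m + 1, by omega⟩ : Fin (m + 2)) = Fin.last (m + 1) := rfl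
  have e2 : (⟨m, by omega⟩ : Fin (m + 2)) = Fin.castSucc (Fin.last m) := rfl
  have e3 : ∀ j : Fin m, Fin.castLE (Nat.le_add_right m 2) j = Fin.castSucc (Fin.castSucc j) :=
    fun j => rfl
  rw [Fin.prod_univ_castSucc, Fin.prod_univ_castSucc]
  simp only [e1, e2, e3, Fin.snocEquiv_apply, Fin.snoc_last, Fin.snoc_castSucc, MvPolynomial.C_mul]
  ring
theorem qpol_eq (k : ℕ) (c : ℝ) : qpol (k + 1) c =
    MvPolynomial.rename Fin.castSucc
      (MvPolynomial.C (-(1 / (c : ℂ) ^ 2)) * MvPolynomial.X 0 ^ 2 +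
        ∑ i : Fin k, MvPolynomial.X i.succ ^ 2 : MvPolynomial (Fin (k + 1)) ℂ)
      + MvPolynomial.X (Fin.last (k + 1)) ^ 2 := by
  have h1 : ∀ a : Fin (k + 2), (∑ b, MvPolynomial.C (gmet (k + 1) c a b : ℂ) *
      (MvPolynomial.X a * MvPolynomial.X b) : MvPolynomial (Fin (k + 2)) ℂ) =
      MvPolynomial.C (gmet (k + 1) c a a : ℂ) * (MvPolynomial.X a * MvPolynomial.X a) := by
    intro a
    apply Finset.sum_eq_single
    · intro b _ hb
      simp [gmet, hb.symm]
    · simp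
  unfold qpol
  rw [Finset.sum_congr rfl fun a _ => h1 a, Fin.sum_univ_succ, Fin.sum_univ_castSucc]
  have h2 : ∀ i : Fin k, (i.castSucc.succ : Fin (k + 2)) = i.succ.castSucc := fun i => rfl
  have h3 : ∀ i : Fin (k + 1), gmet (k + 1) c i.succ i.succ = 1 := by
    intro i; simp [gmet]
  have h4 : gmet (k + 1) c 0 0 = -(1 / c ^ 2) := by simp [gmet]
  rw [h4]
  simp only [h3]
  simp only [map_add, map_mul, map_sum, map_pow, MvPolynomial.rename_X, MvPolynomial.rename_C,
    h2, Complex.ofReal_one, MvPolynomial.C_1, one_mul, Fin.succ_last, ← sq, Fin.castSucc_zero]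
  push_cast
  exact (add_assoc _ _ _).symm

theorem div_qpol (k : ℕ) (c : ℝ) (p : MvPolynomial (Fin (k + 2)) ℂ) :
    ∃ (q : MvPolynomial (Fin (k + 2)) ℂ) (a b : MvPolynomial (Fin (k + 1)) ℂ),
      p = qpol (k + 1) c * q + MvPolynomial.rename Fin.castSucc a +
        MvPolynomial.rename Fin.castSucc b * MvPolynomial.X (Fin.last (k + 1)) := by
  induction p using MvPolynomial.induction_on with
  | C z => exact ⟨0, MvPolynomial.C z, 0, by simp⟩
  | add p₁ p₂ h₁ h₂ =>
    obtain ⟨q₁, a₁, b₁, h₁⟩ := h₁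
    obtain ⟨q₂, a₂, b₂, h₂⟩ := h₂
    refine ⟨q₁ + q₂, a₁ + a₂, b₁ + b₂, ?_⟩
    rw [h₁, h₂]; simp only [map_add]; ring
  | mul_X p i h =>
    obtain ⟨q, a, b, h⟩ := h
    refine Fin.lastCases ?_ (fun i => ?_) i
    · have hq := qpol_eq k c
      set r := (MvPolynomial.C (-(1 / (c : ℂ) ^ 2)) * MvPolynomial.X 0 ^ 2 +
        ∑ i : Fin k, MvPolynomial.X i.succ ^ 2 : MvPolynomial (Fin (k + 1)) ℂ)
      refine ⟨q * MvPolynomial.X (Fin.last (k + 1)) + MvPolynomial.rename Fin.castSucc b,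
        -(b * r), a, ?_⟩
      rw [h, map_neg, map_mul]
      linear_combination (-MvPolynomial.rename Fin.castSucc b) * hq
    · refine ⟨q * MvPolynomial.X i.castSucc, a * MvPolynomial.X i, b * MvPolynomial.X i, ?_⟩
      rw [h]; simp only [map_mul, MvPolynomial.rename_X]; ring

/-- vanishing on the null cone implies divisibility -/
theorem dvd_of_null (k : ℕ) (c : ℝ) (hc : 0 < c) (p : MvPolynomial (Fin (k + 2)) ℂ)
    (h : ∀ v : Fin (k + 2) → ℝ, v 0 ≠ 0 → ∑ i : Fin (k + 1), v i.succ ^ 2 = (v 0 / c) ^ 2 →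
      MvPolynomial.eval (fun i => (v i : ℂ)) p = 0) : qpol (k + 1) c ∣ p := by
  obtain ⟨q, a, b, hp⟩ := div_qpol k c p
  let s : Fin (k + 1) → Set ℂ := fun i =>
    if i = 0 then (fun r : ℝ => (r : ℂ)) '' Set.Ioi (c * (k + 1))
    else (fun r : ℝ => (r : ℂ)) '' Set.Ioo 0 1
  have hs : ∀ i, (s i).Infinite := by
    intro i
    simp only [s]
    split_ifs
    · exact (Set.Ioi_infinite _).image Complex.ofReal_injective.injOn
    · exact (Set.Ioo_infinite one_pos).image Complex.ofReal_injective.injOn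
  have hab : ∀ x ∈ Set.pi Set.univ s, MvPolynomial.eval x a = 0 ∧ MvPolynomial.eval x b = 0 := by
    intro x hx
    have hy : ∀ i, ∃ r : ℝ, (r : ℂ) = x i ∧ (i = 0 → c * (k + 1) < r) ∧
        (i ≠ 0 → 0 < r ∧ r < 1) := by
      intro i
      have h1 := hx i (Set.mem_univ i)
      simp only [s] at h1
      split_ifs at h1 with hi
      · obtain ⟨r, hr, hr'⟩ := h1
        exact ⟨r, hr', fun _ => hr, fun hne => absurd hi hne⟩
      · obtain ⟨r, hr, hr'⟩ := h1
        exact ⟨r, hr', fun h0 => absurd h0 hi, fun _ => hr⟩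
    choose y hyx hy0 hyi using hy
    have hY0 := hy0 0 rfl
    have hpos : 0 < y 0 := lt_trans (by positivity) hY0
    have hsum : ∑ i : Fin k, y i.succ ^ 2 ≤ k := by
      calc ∑ i : Fin k, y i.succ ^ 2 ≤ ∑ i : Fin k, (1 : ℝ) := by
            apply Finset.sum_le_sum
            intro i _
            have := hyi i.succ (Fin.succ_ne_zero i)
            nlinarith [this.1, this.2]
        _ = k := by simp
    have hbig : (k : ℝ) + 1 < y 0 / c := by
      rw [lt_div_iff₀ hc]; linarith
    have hk : (0 : ℝ) ≤ k := Nat.cast_nonneg k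
    have hD : 0 < (y 0 / c) ^ 2 - ∑ i : Fin k, y i.succ ^ 2 := by nlinarith
    set z := Real.sqrt ((y 0 / c) ^ 2 - ∑ i : Fin k, y i.succ ^ 2) with hz
    have hz2 : z ^ 2 = (y 0 / c) ^ 2 - ∑ i : Fin k, y i.succ ^ 2 := Real.sq_sqrt hD.le
    have hzp : 0 < z := Real.sqrt_pos.2 hD
    have main : ∀ w : ℝ, w ^ 2 = z ^ 2 →
        MvPolynomial.eval x a + MvPolynomial.eval x b * (w : ℂ) = 0 := by
      intro w hw
      have e0 : (0 : Fin (k + 2)) = Fin.castSucc 0 := rfl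
      have h2 : ∀ i : Fin k, (i.castSucc.succ : Fin (k + 2)) = i.succ.castSucc := fun i => rfl
      have hn : ∑ i : Fin (k + 1), (Fin.snoc y w : Fin (k + 2) → ℝ) i.succ ^ 2 =
          ((Fin.snoc y w : Fin (k + 2) → ℝ) 0 / c) ^ 2 := by
        rw [Fin.sum_univ_castSucc]
        simp only [h2, Fin.succ_last, Fin.snoc_castSucc, Fin.snoc_last, e0]
        rw [hw, hz2]; ring
      have h1 := h (Fin.snoc y w) (by rw [e0, Fin.snoc_castSucc]; exact hpos.ne') hn
      have hcomp : (fun i => ((Fin.snoc y w : Fin (k + 2) → ℝ) i : ℂ)) ∘ Fin.castSucc = x := by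
        funext i
        simp [hyx]
      have hq0 : MvPolynomial.eval (fun i => ((Fin.snoc y w : Fin (k + 2) → ℝ) i : ℂ))
          (qpol (k + 1) c) = 0 := by
        rw [qpol_eq]
        simp only [map_add, MvPolynomial.eval_rename, hcomp]
        simp only [map_mul, map_sum, map_pow, MvPolynomial.eval_X, MvPolynomial.eval_C,
          Fin.snoc_last, ← hyx]
        have : ((-(1 / c ^ 2) * y 0 ^ 2 + ∑ i : Fin k, y i.succ ^ 2 + w ^ 2 : ℝ) : ℂ) = 0 := by
          rw [hw, hz2]
          norm_cast
          field_simp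
          ring
        rw [← this]; push_cast; rfl
      rw [hp] at h1
      simpa only [map_add, map_mul, MvPolynomial.eval_rename, hcomp, hq0, zero_mul, zero_add,
        MvPolynomial.eval_X, Fin.snoc_last] using h1
    have m1 := main z rfl
    have m2 := main (-z) (by ring)
    push_cast at m2
    have ha : MvPolynomial.eval x a = 0 := by linear_combination (m1 + m2) / 2
    refine ⟨ha, ?_⟩
    rw [ha, zero_add] at m1
    exact (mul_eq_zero.1 m1).resolve_right (by exact_mod_cast hzp.ne')
  have ha : a = 0 := MvPolynomial.funext_set s hs fun x hx => by simp [(hab x hx).1]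
  have hb : b = 0 := MvPolynomial.funext_set s hs fun x hx => by simp [(hab x hx).2]
  exact ⟨q, by rw [hp, ha, hb]; simp⟩

theorem qpol_homog (n : ℕ) (c : ℝ) : (qpol n c).IsHomogeneous 2 := by
  apply MvPolynomial.IsHomogeneous.sum
  intro a _
  apply MvPolynomial.IsHomogeneous.sum
  intro b _
  have := (MvPolynomial.isHomogeneous_C (Fin (n + 1)) (gmet n c a b : ℂ)).mul
    ((MvPolynomial.isHomogeneous_X ℂ a).mul (MvPolynomial.isHomogeneous_X ℂ b))
  simpa using this

theorem qpol_ne_zero (k : ℕ) (c : ℝ) : qpol (k + 1) c ≠ 0 := by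
  intro h
  have h1 := congrArg (MvPolynomial.eval (fun i : Fin (k + 2) =>
    if i = Fin.last (k + 1) then (1 : ℂ) else 0)) h
  rw [qpol_eq] at h1
  simp only [map_add, MvPolynomial.eval_rename, map_mul, map_sum, map_pow, MvPolynomial.eval_X,
    MvPolynomial.eval_C, Function.comp_apply, Fin.castSucc_ne_last] at h1
  simp at h1

theorem hom_comp_mul {n d e : ℕ} {g : MvPolynomial (Fin (n + 1)) ℂ} (hg : g.IsHomogeneous d)
    (q : MvPolynomial (Fin (n + 1)) ℂ) :
    MvPolynomial.homogeneousComponent (d + e) (g * q) =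
      g * MvPolynomial.homogeneousComponent e q := by
  conv_lhs => rw [← MvPolynomial.sum_homogeneousComponent q, Finset.mul_sum, map_sum]
  have h1 : ∀ i, MvPolynomial.homogeneousComponent (d + e)
      (g * MvPolynomial.homogeneousComponent i q) =
      if i = e then g * MvPolynomial.homogeneousComponent e q else 0 := by
    intro i
    have := hg.mul (MvPolynomial.homogeneousComponent_isHomogeneous i q)
    rw [MvPolynomial.homogeneousComponent_of_mem this]
    by_cases hi : i = e
    · simp [hi]
    · have : ¬ (d + e = d + i) := by omega
      rw [if_neg this, if_neg hi]
  rw [Finset.sum_congr rfl fun i _ => h1 i, Finset.sum_ite_eq']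
  split_ifs with he
  · rfl
  · rw [MvPolynomial.homogeneousComponent_eq_zero, mul_zero]
    simp at he; omega

theorem null_small {k m : ℕ} {c : ℝ} {t : (Fin m → Fin (k + 2)) → ℂ}
    (ht : TSym (n := k + 1) t) (hm : m < 2) (hd : qpol (k + 1) c ∣ tpol (n := k + 1) t) : t = 0 := by
  apply tpol_inj (n := k + 1) ht (fun _ _ => rfl)
  have h0 : tpol (n := k + 1) (0 : (Fin m → Fin (k + 2)) → ℂ) = 0 := by simp [tpol]
  rw [h0]
  obtain ⟨q, hq⟩ := hd
  by_contra hne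
  have hq0 : q ≠ 0 := by rintro rfl; simp [hq] at hne
  have h1 := MvPolynomial.totalDegree_mul_of_isDomain (qpol_ne_zero k c) hq0
  rw [← hq, (qpol_homog _ _).totalDegree (qpol_ne_zero k c), (tpol_homog t).totalDegree hne] at h1
  omega

theorem null_large {k m : ℕ} {c : ℝ} {t : (Fin (m + 2) → Fin (k + 2)) → ℂ}
    (ht : TSym (n := k + 1) t) (hd : qpol (k + 1) c ∣ tpol (n := k + 1) t) :
    ∃ u : (Fin m → Fin (k + 2)) → ℂ, TSym (n := k + 1) u ∧ t = iOpT (k + 1) m (gmet (k + 1) c) u := by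
  obtain ⟨q, hq⟩ := hd
  obtain ⟨u, hu, huq⟩ := tpol_surj (MvPolynomial.homogeneousComponent_isHomogeneous m q)
  refine ⟨u, hu, tpol_inj ht (iOpT_sym _ _) ?_⟩
  rw [tpol_iOpT, huq, ← hom_comp_mul (qpol_homog _ _), ← hq]
  rw [add_comm 2 m]
  exact (MvPolynomial.homogeneousComponent_eq_self (tpol_homog t)).symm

/-- symmetric tensors as a submodule -/
def symSub (n m : ℕ) : Submodule ℂ ((Fin m → Fin (n + 1)) → ℂ) where
  carrier := {t | TSym t}
  add_mem' := fun ha hb σ i => by simp only [Pi.add_apply]; rw [ha σ i, hb σ i]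
  zero_mem' := fun _ _ => rfl
  smul_mem' := fun z t ht σ i => by simp only [Pi.smul_apply]; rw [ht σ i]

/-- `iOpT` as a linear map -/
def iOpL (n m : ℕ) (v : Fin (n + 1) → Fin (n + 1) → ℝ) :
    symSub n m →ₗ[ℂ] ((Fin (m + 2) → Fin (n + 1)) → ℂ) where
  toFun := fun u => iOpT n m v u.1
  map_add' := fun a b => by
    funext i
    simp only [iOpT, Submodule.coe_add, Pi.add_apply, add_mul, Finset.sum_add_distrib, mul_add]
  map_smul' := fun a b => by
    funext i
    simp only [iOpT, Submodule.coe_smul, Pi.smul_apply, smul_eq_mul, RingHom.id_apply,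
      Finset.mul_sum]
    refine Finset.sum_congr rfl fun π _ => ?_
    ring

theorem exists_field {n m : ℕ} (v : Fin (n + 1) → Fin (n + 1) → ℝ)
    (f : (Fin (m + 2) → Fin (n + 1)) → (Fin (n + 1) → ℝ) → ℂ) (hreg : IsCc n (m + 2) f)
    (h : ∀ x, ∃ u : (Fin m → Fin (n + 1)) → ℂ, TSym u ∧ (fun i => f i x) = iOpT n m v u) :
    ∃ u : (Fin m → Fin (n + 1)) → (Fin (n + 1) → ℝ) → ℂ,
        IsSymmF n m u ∧ IsCc n m u ∧ ∀ i x, f i x = iOpF n m v u i x := by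
  obtain ⟨g, hg⟩ := (iOpL n m v).rangeRestrict.exists_rightInverse_of_surjective
    (LinearMap.range_rangeRestrict _)
  obtain ⟨B, hB⟩ := LinearMap.exists_extend g
  refine ⟨fun j x => (B (fun i => f i x)).1 j, ?_, ?_, ?_⟩
  · intro σ i
    funext x
    exact (B (fun i => f i x)).2 σ i
  · intro j
    have h1 : (fun x => (B (fun i => f i x)).1 j) =
        fun x => ∑ i, f i x * (B (Pi.single i 1)).1 j := by
      funext x
      rw [LinearMap.pi_apply_eq_sum_univ B]
      simp [Finset.sum_apply]
      refine Finset.sum_congr rfl fun i _ => ?_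
      have e : (fun j => if i = j then (1 : ℂ) else 0) = Pi.single i 1 := by
        funext k
        simp [Pi.single_apply, eq_comm]
      rw [e]
    beta_reduce
    rw [h1]
    constructor
    · exact ContDiff.sum fun i _ => (hreg i).1.mul contDiff_const
    · have : ∀ s : Finset (Fin (m + 2) → Fin (n + 1)), HasCompactSupport
          (fun x => ∑ i ∈ s, f i x * (B (Pi.single i 1)).1 j) := by
        intro s
        induction s using Finset.induction_on with
        | empty =>
          simp only [Finset.sum_empty]
          exact HasCompactSupport.zero
        | insert a s ha ih =>
          simp only [Finset.sum_insert ha]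
          exact ((hreg a).2.mul_right).add ih
      exact this univ
  · intro i x
    obtain ⟨u, hu, hfu⟩ := h x
    have hr : (fun i => f i x) ∈ LinearMap.range (iOpL n m v) := ⟨⟨u, hu⟩, hfu.symm⟩
    have h1 : B (fun i => f i x) = g ⟨_, hr⟩ := by
      rw [← hB]; rfl
    have h2 := LinearMap.congr_fun hg ⟨_, hr⟩
    have h3 := congrArg (fun z => z.1 i) h2
    simp only [LinearMap.comp_apply, LinearMap.id_apply, ← h1] at h3
    rw [← h3]
    rfl
theorem pow_dvd_of_bound (k : ℕ) (Q : Polynomial ℂ) (K : ℝ)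
    (h : ∀ τ : ℝ, τ ≠ 0 → ‖Q.eval (τ : ℂ)‖ ≤ K * |τ| ^ k) :
    ∃ S : Polynomial ℂ, Q = Polynomial.X ^ k * S ∧ ∀ τ : ℝ, τ ≠ 0 → ‖S.eval (τ : ℂ)‖ ≤ K := by
  induction k generalizing Q with
  | zero => exact ⟨Q, by simp, by simpa using h⟩
  | succ k ih =>
    have h0 : Q.eval 0 = 0 := by
      have hcont : Continuous fun τ : ℝ => ‖Q.eval (τ : ℂ)‖ := by fun_prop
      have t1 : Filter.Tendsto (fun τ : ℝ => ‖Q.eval (τ : ℂ)‖) (nhdsWithin 0 {0}ᶜ)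
          (nhds ‖Q.eval ((0 : ℝ) : ℂ)‖) := (hcont.tendsto 0).mono_left nhdsWithin_le_nhds
      have hcont2 : Continuous fun τ : ℝ => K * |τ| ^ (k + 1) := by fun_prop
      have t2 : Filter.Tendsto (fun τ : ℝ => K * |τ| ^ (k + 1)) (nhdsWithin 0 {0}ᶜ)
          (nhds (K * |(0 : ℝ)| ^ (k + 1))) := (hcont2.tendsto 0).mono_left nhdsWithin_le_nhds
      have := le_of_tendsto_of_tendsto t1 t2 (by
        filter_upwards [self_mem_nhdsWithin] with τ hτ
        exact h τ hτ)
      simpa using this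
    obtain ⟨Q', hQ'⟩ := Polynomial.dvd_iff_isRoot.2 (show Q.IsRoot 0 from h0)
    rw [Polynomial.C_0, sub_zero] at hQ'
    obtain ⟨S, hS, hb⟩ := ih Q' (by
      intro τ hτ
      have h1 := h τ hτ
      rw [hQ', Polynomial.eval_mul, Polynomial.eval_X, norm_mul, Complex.norm_real,
        Real.norm_eq_abs, pow_succ] at h1
      have hp : 0 < |τ| := abs_pos.2 hτ
      have : |τ| * ‖Q'.eval (τ : ℂ)‖ ≤ |τ| * (K * |τ| ^ k) := by linarith
      exact le_of_mul_le_mul_left this hp)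
    exact ⟨S, by rw [hQ', hS, pow_succ]; ring, hb⟩

theorem poly_zero (k : ℕ) (P Λ : Polynomial ℂ) (K : ℝ) (hΛ0 : Λ.eval 0 ≠ 0) (hΛ : 0 < Λ.degree)
    (h : ∀ τ : ℝ, τ ≠ 0 → ‖(P * Λ).eval (τ : ℂ)‖ ≤ K * |τ| ^ k) : P = 0 := by
  obtain ⟨S, hS, hb⟩ := pow_dvd_of_bound k _ K h
  have hdeg : S.degree ≤ 0 := by
    by_contra hd
    rw [not_le] at hd
    have ht := S.tendsto_norm_atTop hd (l := Filter.atTop) (z := fun τ : ℝ => (τ : ℂ)) (by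
      simp only [Complex.norm_real, Real.norm_eq_abs]
      exact Filter.tendsto_abs_atTop_atTop)
    obtain ⟨τ, h1, h2⟩ := ((ht.eventually_gt_atTop K).and (Filter.eventually_gt_atTop 0)).exists
    exact absurd (hb τ h2.ne') (not_le.2 h1)
  rw [Polynomial.eq_C_of_degree_le_zero hdeg] at hS
  obtain ⟨z, hz⟩ := IsAlgClosed.exists_root Λ hΛ.ne'
  have hz0 : z ≠ 0 := by
    rintro rfl; exact hΛ0 hz
  have h1 := congrArg (Polynomial.eval z) hS
  rw [Polynomial.eval_mul, hz, mul_zero] at h1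
  simp only [Polynomial.eval_mul, Polynomial.eval_pow, Polynomial.eval_X, Polynomial.eval_C] at h1
  have h2 : S.coeff 0 = 0 := (mul_eq_zero.1 h1.symm).resolve_left (pow_ne_zero _ hz0)
  rw [h2, Polynomial.C_0, mul_zero] at hS
  refine (mul_eq_zero.1 hS).resolve_right ?_
  rintro rfl
  simp at hΛ

theorem sph_dot_ne {n : ℕ} {a b : Fin n → ℝ} (ha : onSphere n a) (hb : onSphere n b) (hab : a ≠ b) :
    1 - ∑ i, a i * b i ≠ 0 := by
  intro h
  apply hab
  have h1 : ∑ i, (a i - b i) ^ 2 = 0 := by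
    have : ∀ i, (a i - b i) ^ 2 = a i ^ 2 + b i ^ 2 - 2 * (a i * b i) := fun i => by ring
    simp only [this, Finset.sum_sub_distrib, Finset.sum_add_distrib, ← Finset.mul_sum]
    unfold onSphere at ha hb
    linarith
  funext i
  rw [Finset.sum_eq_zero_iff_of_nonneg (fun i _ => sq_nonneg _)] at h1
  have := h1 i (Finset.mem_univ i)
  nlinarith [pow_eq_zero_iff (two_ne_zero) |>.1 this]

theorem hom_null {n m : ℕ} {c : ℝ} (hc : 0 < c) (t : (Fin m → Fin (n + 1)) → ℂ)
    (v : Fin (n + 1) → ℝ) (l : ℝ) (hl : l ≠ 0) (h0 : v 0 = l * c)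
    (hs : ∑ i : Fin n, v i.succ ^ 2 = l ^ 2) :
    ∃ ω, onSphere n ω ∧ (∀ i, v i = l * ld n c ω i) ∧
      ∑ i, t i * ∏ j, (v (i j) : ℂ) = (l : ℂ) ^ m * ∑ i, (∏ j, (ld n c ω (i j) : ℂ)) * t i := by
  have hv : ∀ i, v i = l * ld n c (fun i => v i.succ / l) i := by
    intro i
    refine Fin.cases ?_ (fun i => ?_) i
    · simp [ld, h0]
    · simp [ld]; field_simp
  refine ⟨fun i => v i.succ / l, ?_, hv, ?_⟩
  · unfold onSphere
    simp only [div_pow]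
    rw [← Finset.sum_div, hs]
    field_simp
  · rw [Finset.mul_sum]
    refine Finset.sum_congr rfl fun i _ => ?_
    have : ∀ j, (v (i j) : ℂ) = (l : ℂ) * (ld n c (fun i => v i.succ / l) (i j) : ℂ) := by
      intro j; rw [← Complex.ofReal_mul, ← hv]
    rw [Finset.prod_congr rfl fun j _ => this j, Finset.prod_mul_distrib]
    simp
    ring

theorem conic {n m : ℕ} {c : ℝ} (hc : 0 < c) (t : (Fin m → Fin (n + 1)) → ℂ) (ξ : Fin (n + 1) → ℝ)
    (K : ℝ) (hK : ∀ ω, onSphere n ω → ‖∑ i, (∏ j, (ld n c ω (i j) : ℂ)) * t i‖ ≤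
      K * |∑ i, ξ i * ld n c ω i| ^ (m + 1))
    (a b : Fin n → ℝ) (ha : onSphere n a) (hb : onSphere n b) (hab : a ≠ b)
    (hξa : ∑ i, ξ i * ld n c a i = 0) (hξb : ∑ i, ξ i * ld n c b i = 0)
    (θ : Fin n → ℝ) (hθ : onSphere n θ) : ∑ i, (∏ j, (ld n c θ (i j) : ℂ)) * t i = 0 := by
  by_cases hθa : a = θ
  · subst hθa
    have := hK _ hθ
    rw [hξa] at this
    simpa using this
  by_cases hθb : b = θ
  · subst hθb
    have := hK _ hθ
    rw [hξb] at this
    simpa using this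
  have hκ := sph_dot_ne ha hb hab
  have hp := sph_dot_ne ha hθ hθa
  have hq := sph_dot_ne hb hθ hθb
  set D := ∑ i, a i * b i
  set p := ∑ i, a i * θ i
  set q := ∑ i, b i * θ i
  set α := (1 - q) / (1 - D) with hα
  set β := (1 - p) / (1 - D) with hβ
  have hα0 : α ≠ 0 := div_ne_zero hq hκ
  have hβ0 : β ≠ 0 := div_ne_zero hp hκ
  have hακ : α * (1 - D) = 1 - q := div_mul_cancel₀ _ hκ
  have hβκ : β * (1 - D) = 1 - p := div_mul_cancel₀ _ hκ
  -- real curve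
  let A : ℝ → ℝ := fun τ => α * (1 - τ)
  let B : ℝ → ℝ := fun τ => β * (τ ^ 2 - τ)
  let v : ℝ → Fin (n + 1) → ℝ := fun τ i =>
    A τ * ld n c a i + B τ * ld n c b i + τ * ld n c θ i
  let l : ℝ → ℝ := fun τ => A τ + B τ + τ
  have hv0 : ∀ τ, v τ 0 = l τ * c := by
    intro τ; simp only [v, l, ld, Fin.cons_zero]; ring
  have hvs : ∀ τ, ∑ i : Fin n, v τ i.succ ^ 2 = l τ ^ 2 := by
    intro τ
    have : ∀ i : Fin n, v τ i.succ ^ 2 = A τ ^ 2 * a i ^ 2 + B τ ^ 2 * b i ^ 2 + τ ^ 2 * θ i ^ 2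
        + 2 * A τ * B τ * (a i * b i) + 2 * A τ * τ * (a i * θ i) + 2 * B τ * τ * (b i * θ i) := by
      intro i; simp only [v, ld, Fin.cons_succ]; ring
    simp only [this, Finset.sum_add_distrib, ← Finset.mul_sum]
    unfold onSphere at ha hb hθ
    rw [ha, hb, hθ]
    change A τ ^ 2 * 1 + B τ ^ 2 * 1 + τ ^ 2 * 1 + 2 * A τ * B τ * D + 2 * A τ * τ * p +
      2 * B τ * τ * q = (A τ + B τ + τ) ^ 2
    have e1 : p = 1 - β * (1 - D) := by linarith
    have e2 : q = 1 - α * (1 - D) := by linarith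
    rw [e1, e2]
    simp only [A, B]
    ring
  have hξv : ∀ τ, ∑ i, ξ i * v τ i = τ * ∑ i, ξ i * ld n c θ i := by
    intro τ
    have : ∀ i, ξ i * v τ i = A τ * (ξ i * ld n c a i) + B τ * (ξ i * ld n c b i)
        + τ * (ξ i * ld n c θ i) := by
      intro i; simp only [v]; ring
    simp only [this, Finset.sum_add_distrib, ← Finset.mul_sum, hξa, hξb]
    ring
  let P : Polynomial ℂ := ∑ i, Polynomial.C (t i) * ∏ j,
    (Polynomial.C ((α * ld n c a (i j) : ℝ) : ℂ) * (1 - Polynomial.X) +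
      Polynomial.C ((β * ld n c b (i j) : ℝ) : ℂ) * (Polynomial.X ^ 2 - Polynomial.X) +
      Polynomial.C ((ld n c θ (i j) : ℝ) : ℂ) * Polynomial.X)
  let Λ : Polynomial ℂ := Polynomial.C ((β : ℝ) : ℂ) * Polynomial.X ^ 2 +
    Polynomial.C ((1 - α - β : ℝ) : ℂ) * Polynomial.X + Polynomial.C ((α : ℝ) : ℂ)
  have hP : ∀ τ : ℝ, P.eval (τ : ℂ) = ∑ i, t i * ∏ j, (v τ (i j) : ℂ) := by
    intro τ
    simp only [P, Polynomial.eval_finsetSum, Polynomial.eval_mul, Polynomial.eval_prod,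
      Polynomial.eval_add, Polynomial.eval_sub, Polynomial.eval_pow, Polynomial.eval_X,
      Polynomial.eval_C, Polynomial.eval_one, v, A, B]
    refine Finset.sum_congr rfl fun i _ => ?_
    congr 1
    refine Finset.prod_congr rfl fun j _ => ?_
    push_cast
    ring
  have hΛ : ∀ τ : ℝ, Λ.eval (τ : ℂ) = (l τ : ℂ) := by
    intro τ
    simp only [Λ, l, A, B, Polynomial.eval_mul, 
      Polynomial.eval_add, Polynomial.eval_pow, Polynomial.eval_X,
      Polynomial.eval_C]
    push_cast
    ring
  have hP0 : P = 0 := by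
    refine poly_zero (m + 1) P Λ (K * |∑ i, ξ i * ld n c θ i| ^ (m + 1)) ?_ ?_ ?_
    · have := hΛ 0
      simp only [Complex.ofReal_zero] at this
      rw [this]
      simp [l, A, B, hα0]
    · have : Λ.degree = 2 := Polynomial.degree_quadratic (by exact_mod_cast hβ0)
      rw [this]; norm_num
    · intro τ _
      rw [Polynomial.eval_mul, hP, hΛ, norm_mul, Complex.norm_real, Real.norm_eq_abs]
      have hKnn : 0 ≤ K * |∑ i, ξ i * ld n c θ i| ^ (m + 1) := (norm_nonneg _).trans (hK θ hθ)
      by_cases hl : l τ = 0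
      · rw [hl]; simp only [abs_zero, mul_zero]; positivity
      obtain ⟨ω, hω, hvω, hsum⟩ := hom_null hc t (v τ) (l τ) hl (hv0 τ) (hvs τ)
      rw [hsum, norm_mul, norm_pow, Complex.norm_real, Real.norm_eq_abs]
      have e : τ * ∑ i, ξ i * ld n c θ i = l τ * ∑ i, ξ i * ld n c ω i := by
        rw [← hξv, Finset.mul_sum]
        refine Finset.sum_congr rfl fun i _ => ?_
        rw [hvω]; ring
      have e2 : |l τ| ^ (m + 1) * |∑ i, ξ i * ld n c ω i| ^ (m + 1) =
          |∑ i, ξ i * ld n c θ i| ^ (m + 1) * |τ| ^ (m + 1) := by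
        rw [← mul_pow, ← abs_mul, ← e, abs_mul, mul_pow, mul_comm]
      calc _ = |l τ| ^ (m + 1) * ‖∑ i, (∏ j, (ld n c ω (i j) : ℂ)) * t i‖ := by ring
        _ ≤ |l τ| ^ (m + 1) * (K * |∑ i, ξ i * ld n c ω i| ^ (m + 1)) := by
          gcongr; exact hK ω hω
        _ = _ := by rw [mul_left_comm, e2]; ring
  have h1 := hP 1
  rw [hP0, Polynomial.eval_zero] at h1
  rw [h1]
  refine Finset.sum_congr rfl fun i _ => ?_
  rw [mul_comm]
  congr 1
  refine Finset.prod_congr rfl fun j _ => ?_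
  simp [v, A, B]

theorem exists_ab {k : ℕ} {c : ℝ} (ξ : Fin (k + 3) → ℝ)
    (hξ : (c * ξ 0) ^ 2 < ξ 1 ^ 2 + ξ 2 ^ 2) :
    ∃ a b : Fin (k + 2) → ℝ, onSphere (k + 2) a ∧ onSphere (k + 2) b ∧ a ≠ b ∧
      ∑ i, ξ i * ld (k + 2) c a i = 0 ∧ ∑ i, ξ i * ld (k + 2) c b i = 0 := by
  set r := ξ 1 ^ 2 + ξ 2 ^ 2 with hr
  have hrp : 0 < r := lt_of_le_of_lt (sq_nonneg _) hξ
  set d := Real.sqrt (r - (c * ξ 0) ^ 2) with hd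
  have hd2 : d ^ 2 = r - (c * ξ 0) ^ 2 := Real.sq_sqrt (by linarith)
  have hdp : 0 < d := Real.sqrt_pos.2 (by linarith)
  let vec : ℝ → Fin (k + 2) → ℝ := fun e =>
    Fin.cons ((-(c * ξ 0) * ξ 1 - e * ξ 2) / r)
      (Fin.cons ((-(c * ξ 0) * ξ 2 + e * ξ 1) / r) 0)
  have h1 : ∀ e, e ^ 2 = d ^ 2 → onSphere (k + 2) (vec e) := by
    intro e he
    unfold onSphere
    simp only [Fin.sum_univ_succ, vec, Fin.cons_zero, Fin.cons_succ]
    simp only [Pi.zero_apply]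
    simp
    field_simp
    rw [hd2] at he
    have : e ^ 2 = ξ 1 ^ 2 + ξ 2 ^ 2 - (c * ξ 0) ^ 2 := by rw [he]
    linear_combination (ξ 1 ^ 2 + ξ 2 ^ 2) * this - (r + ξ 1 ^ 2 + ξ 2 ^ 2) * hr
  have e1 : (Fin.succ 0 : Fin (k + 3)) = 1 := rfl
  have e2 : (Fin.succ (Fin.succ 0) : Fin (k + 3)) = 2 := rfl
  have h2 : ∀ e, ∑ i, ξ i * ld (k + 2) c (vec e) i = 0 := by
    intro e
    simp only [Fin.sum_univ_succ, vec, ld, Fin.cons_zero, Fin.cons_succ, e1, e2]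
    simp only [Pi.zero_apply, mul_zero, Finset.sum_const_zero]
    field_simp
    linear_combination (ξ 0 * c) * hr
  refine ⟨vec d, vec (-d), h1 d rfl, h1 (-d) (by ring), ?_, h2 _, h2 _⟩
  intro heq
  have g0 := congrFun heq 0
  have g1 := congrFun heq 1
  have e3 : (1 : Fin (k + 2)) = Fin.succ 0 := rfl
  rw [e3] at g1
  simp only [vec, Fin.cons_zero, Fin.cons_succ] at g0 g1
  rw [div_left_inj' hrp.ne'] at g0 g1
  have : 2 * d * r = 0 := by
    rw [hr]
    linear_combination (-ξ 2) * g0 + ξ 1 * g1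
  have : 0 < 2 * d * r := by positivity
  linarith
/-- Euclidean pairing -/
def dt {n : ℕ} (ξ x : Fin (n + 1) → ℝ) : ℝ := ∑ i, ξ i * x i

theorem dt_cont {n : ℕ} (ξ : Fin (n + 1) → ℝ) : Continuous (dt ξ) := by
  unfold dt; fun_prop

theorem dt_add {n : ℕ} (ξ x y : Fin (n + 1) → ℝ) : dt ξ (x + y) = dt ξ x + dt ξ y := by
  simp [dt, mul_add, Finset.sum_add_distrib]

theorem dt_smul {n : ℕ} (ξ x : Fin (n + 1) → ℝ) (s : ℝ) : dt ξ (s • x) = s * dt ξ x := by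
  simp only [dt, Pi.smul_apply, smul_eq_mul, Finset.mul_sum]
  exact Finset.sum_congr rfl fun i _ => by ring

/-- Fourier transform -/
def FT {n : ℕ} (h : (Fin (n + 1) → ℝ) → ℂ) (ξ : Fin (n + 1) → ℝ) : ℂ :=
  ∫ x, Complex.exp (-(Complex.I * (dt ξ x : ℂ))) * h x

theorem FT_inj {n : ℕ} (h : (Fin (n + 1) → ℝ) → ℂ) (hc : Continuous h) (hs : HasCompactSupport h)
    (h0 : ∀ ξ, FT h ξ = 0) : ∀ x, h x = 0 := by
  let H : EuclideanSpace ℝ (Fin (n + 1)) → ℂ := fun x => h (WithLp.ofLp x)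
  have hHc : Continuous H := hc.comp (PiLp.continuous_ofLp 2 _)
  have hHi : Integrable H := by
    have := (PiLp.volume_preserving_ofLp (Fin (n + 1))).integrable_comp_emb
      (MeasurableEquiv.toLp 2 (Fin (n + 1) → ℝ)).symm.measurableEmbedding (g := h)
    exact this.2 (hc.integrable_of_hasCompactSupport hs)
  have hF : FourierTransform.fourier H = 0 := by
    funext w
    rw [Real.fourier_eq']
    have h1 := h0 (fun i => 2 * Real.pi * w i)
    unfold FT at h1
    rw [← (PiLp.volume_preserving_ofLp (Fin (n + 1))).integral_comp
      (MeasurableEquiv.toLp 2 (Fin (n + 1) → ℝ)).symm.measurableEmbedding] at h1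
    rw [Pi.zero_apply, ← h1]
    congr 1
    funext v
    rw [smul_eq_mul]
    congr 2
    simp only [dt, PiLp.inner_apply, RCLike.inner_apply, conj_trivial]
    rw [mul_comm, ← mul_neg, ← Complex.ofReal_neg]
    congr 2
    rw [Finset.mul_sum, ← Finset.sum_neg_distrib]
    exact Finset.sum_congr rfl fun i _ => by ring
  have h2 := hHc.fourierInv_fourier_eq hHi (by rw [hF]; exact integrable_zero _ _ _)
  rw [hF] at h2
  intro x
  have h3 := congrFun h2 (WithLp.toLp 2 x)
  rw [Real.fourierInv_eq] at h3
  simpa [H] using h3.symm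

theorem FT_line {n : ℕ} (h : (Fin (n + 1) → ℝ) → ℂ) (hc : Continuous h) (hs : HasCompactSupport h)
    (ξ η : Fin (n + 1) → ℝ) : Differentiable ℂ fun z : ℂ =>
      ∫ x, Complex.exp (-(Complex.I * ((dt ξ x : ℂ) + z * (dt η x : ℂ)))) * h x := by
  intro z₀
  have c1 : Continuous fun x => (dt ξ x : ℂ) := Complex.continuous_ofReal.comp (dt_cont ξ)
  have c2 : Continuous fun x => (dt η x : ℂ) := Complex.continuous_ofReal.comp (dt_cont η)
  have cF : ∀ z : ℂ, Continuous fun x =>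
      Complex.exp (-(Complex.I * ((dt ξ x : ℂ) + z * (dt η x : ℂ)))) * h x := by
    intro z; fun_prop
  refine (hasDerivAt_integral_of_dominated_loc_of_deriv_le (𝕜 := ℂ)
    (s := Metric.ball z₀ 1)
    (F := fun z x => Complex.exp (-(Complex.I * ((dt ξ x : ℂ) + z * (dt η x : ℂ)))) * h x)
    (F' := fun z x => Complex.exp (-(Complex.I * ((dt ξ x : ℂ) + z * (dt η x : ℂ)))) *
      (-(Complex.I * (dt η x : ℂ))) * h x)
    (bound := fun x => Real.exp (‖(dt ξ x : ℂ)‖ + (‖z₀‖ + 1) * ‖(dt η x : ℂ)‖) * ‖(dt η x : ℂ)‖ * ‖h x‖)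
    (Metric.ball_mem_nhds _ one_pos) ?_ ?_ ?_ ?_ ?_ ?_).2.differentiableAt
  · exact Filter.Eventually.of_forall fun z => (cF z).aestronglyMeasurable
  · exact (cF z₀).integrable_of_hasCompactSupport hs.mul_left
  · exact Continuous.aestronglyMeasurable (by fun_prop)
  · refine Filter.Eventually.of_forall fun x z hz => ?_
    rw [norm_mul, norm_mul, norm_neg, norm_mul, Complex.norm_I, one_mul]
    gcongr
    refine (Complex.norm_exp_le_exp_norm _).trans ?_
    rw [Real.exp_le_exp, norm_neg, norm_mul, Complex.norm_I, one_mul]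
    refine (norm_add_le _ _).trans ?_
    rw [norm_mul]
    gcongr
    have : ‖z - z₀‖ < 1 := by simpa [dist_eq_norm] using hz
    have h2 := norm_sub_norm_le z z₀
    linarith
  · refine Continuous.integrable_of_hasCompactSupport (by fun_prop) ?_
    exact hs.norm.mul_left
  · refine Filter.Eventually.of_forall fun x z _ => ?_
    have h1 : HasDerivAt (fun z : ℂ => -(Complex.I * ((dt ξ x : ℂ) + z * (dt η x : ℂ))))
        (-(Complex.I * (dt η x : ℂ))) z := by
      have := (((hasDerivAt_id z).mul_const (dt η x : ℂ)).const_add (dt ξ x : ℂ)).const_mul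
        Complex.I |>.neg
      exact this.congr_deriv (by ring)
    exact (h1.cexp).mul_const (h x)

theorem FT_open {n : ℕ} (h : (Fin (n + 1) → ℝ) → ℂ) (hc : Continuous h) (hs : HasCompactSupport h)
    (U : Set (Fin (n + 1) → ℝ)) (hU : IsOpen U) (ξ₀ : Fin (n + 1) → ℝ) (hξ₀ : ξ₀ ∈ U)
    (h0 : ∀ ξ ∈ U, FT h ξ = 0) : ∀ x, h x = 0 := by
  apply FT_inj h hc hs
  intro ξ
  let g : ℂ → ℂ := fun z =>
      ∫ x, Complex.exp (-(Complex.I * ((dt ξ₀ x : ℂ) + z * (dt (ξ - ξ₀) x : ℂ)))) * h x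
  have hg : AnalyticOnNhd ℂ g Set.univ :=
    (FT_line h hc hs ξ₀ (ξ - ξ₀)).differentiableOn.analyticOnNhd isOpen_univ
  have hgr : ∀ r : ℝ, g r = FT h (ξ₀ + r • (ξ - ξ₀)) := by
    intro r
    simp only [g, FT]
    congr 1
    funext x
    congr 4
    have : dt (ξ₀ + r • (ξ - ξ₀)) x = dt ξ₀ x + r * dt (ξ - ξ₀) x := by
      simp only [dt, Pi.add_apply, Pi.smul_apply, smul_eq_mul, Finset.mul_sum, add_mul,
        Finset.sum_add_distrib, mul_assoc]
    rw [this]; push_cast; rfl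
  have hcont : Continuous fun r : ℝ => ξ₀ + r • (ξ - ξ₀) := by fun_prop
  have hev : ∀ᶠ r : ℝ in nhds 0, g r = 0 := by
    have : ∀ᶠ r : ℝ in nhds 0, ξ₀ + r • (ξ - ξ₀) ∈ U :=
      hcont.tendsto 0 |>.eventually (hU.mem_nhds (by simpa using hξ₀))
    filter_upwards [this] with r hr
    rw [hgr]; exact h0 _ hr
  have hfr : ∃ᶠ z in nhdsWithin (0 : ℂ) {0}ᶜ, g z = (fun _ => (0 : ℂ)) z := by
    have t : Filter.Tendsto (fun r : ℝ => (r : ℂ)) (nhdsWithin 0 {0}ᶜ) (nhdsWithin 0 {0}ᶜ) := by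
      apply tendsto_nhdsWithin_iff.2
      constructor
      · have := (Complex.continuous_ofReal.tendsto (0 : ℝ)).mono_left
          (nhdsWithin_le_nhds (s := {(0 : ℝ)}ᶜ))
        simpa using this
      · filter_upwards [self_mem_nhdsWithin] with r hr
        simpa using hr
    refine t.frequently ?_
    exact (hev.filter_mono nhdsWithin_le_nhds).frequently
  have hz := hg.eq_of_frequently_eq analyticOnNhd_const hfr
  have := congrFun hz ((1 : ℝ) : ℂ)
  rw [hgr] at this
  simpa using this

theorem zero_of_rays {n : ℕ} {c : ℝ} (hc : 0 < c) (ω : Fin n → ℝ) (G : (Fin (n + 1) → ℝ) → ℂ)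
    (hG : Continuous G) (hGs : HasCompactSupport G)
    (h : ∀ x, ∫ s : ℝ, G (x + s • ld n c ω) = 0) : ∫ x, G x = 0 := by
  let φ : ℝ × (Fin n → ℝ) → (Fin (n + 1) → ℝ) := fun p => Fin.cons p.1 (p.2 + (p.1 / c) • ω)
  let ψ : (Fin (n + 1) → ℝ) → ℝ × (Fin n → ℝ) := fun x => (x 0, Fin.tail x - (x 0 / c) • ω)
  have cons_cont : Continuous fun p : ℝ × (Fin n → ℝ) => (Fin.cons p.1 p.2 : Fin (n + 1) → ℝ) := by
    refine continuous_pi fun i => ?_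
    refine Fin.cases ?_ (fun i => ?_) i
    · simpa using continuous_fst
    · simp only [Fin.cons_succ]; fun_prop
  have hφ : Continuous φ := by
    have : φ = (fun p : ℝ × (Fin n → ℝ) => (Fin.cons p.1 p.2 : Fin (n + 1) → ℝ)) ∘
      fun p => (p.1, p.2 + (p.1 / c) • ω) := rfl
    rw [this]
    exact cons_cont.comp (by fun_prop)
  have hψ : Continuous ψ := by
    have : Continuous fun x : Fin (n + 1) → ℝ => Fin.tail x := by
      refine continuous_pi fun i => ?_
      simp only [Fin.tail]; fun_prop
    fun_prop
  have hψφ : ∀ p, ψ (φ p) = p := by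
    intro p
    simp [ψ, φ]
  have hintg : Integrable (fun p => G (φ p)) ((volume : Measure ℝ).prod (volume : Measure (Fin n → ℝ))) := by
    refine Continuous.integrable_of_hasCompactSupport (hG.comp hφ) ?_
    refine HasCompactSupport.intro (hGs.isCompact.image hψ) fun p hp => ?_
    by_contra hne
    exact hp ⟨φ p, subset_tsupport _ hne, hψφ p⟩
  have hint0 : Integrable (fun p : ℝ × (Fin n → ℝ) => G (Fin.cons p.1 p.2))
      ((volume : Measure ℝ).prod (volume : Measure (Fin n → ℝ))) := by
    refine Continuous.integrable_of_hasCompactSupport (hG.comp cons_cont) ?_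
    have ct : Continuous fun x : Fin (n + 1) → ℝ => (x 0, Fin.tail x) := by
      refine Continuous.prodMk (by fun_prop) (continuous_pi fun i => ?_)
      simp only [Fin.tail]; fun_prop
    refine HasCompactSupport.intro (hGs.isCompact.image ct) fun p hp => ?_
    by_contra hne
    exact hp ⟨Fin.cons p.1 p.2, subset_tsupport _ hne, by simp⟩
  have e1 := (volume_preserving_piFinSuccAbove (fun _ : Fin (n + 1) => ℝ) 0).symm.integral_comp
    (MeasurableEquiv.piFinSuccAbove (fun _ : Fin (n + 1) => ℝ) 0).symm.measurableEmbedding G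
  rw [← e1]
  have e2 : ∀ p : ℝ × (Fin n → ℝ),
      (MeasurableEquiv.piFinSuccAbove (fun _ : Fin (n + 1) => ℝ) 0).symm p = Fin.cons p.1 p.2 := by
    intro p
    simp [MeasurableEquiv.piFinSuccAbove]
    rfl
  simp only [e2]
  rw [Measure.volume_eq_prod, integral_prod _ hint0]
  have e3 : ∀ s : ℝ, ∫ y : Fin n → ℝ, G (Fin.cons s y) = ∫ y : Fin n → ℝ, G (φ (s, y)) := by
    intro s
    exact (integral_add_right_eq_self (fun y : Fin n → ℝ => G (Fin.cons s y)) ((s / c) • ω)).symm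
  simp only [e3]
  rw [integral_integral_swap (f := fun s y => G (φ (s, y))) hintg]
  have e4 : ∀ y : Fin n → ℝ, ∫ s : ℝ, G (φ (s, y)) = 0 := by
    intro y
    have h1 := Measure.integral_comp_mul_left (fun s => G (φ (s, y))) c
    have h2 : ∀ s : ℝ, φ (c * s, y) = (Fin.cons 0 y : Fin (n + 1) → ℝ) + s • ld n c ω := by
      intro s
      funext i
      refine Fin.cases ?_ (fun i => ?_) i
      · simp [φ, ld]; ring
      · simp only [φ, ld, Fin.cons_succ, Pi.add_apply, Pi.smul_apply, smul_eq_mul]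
        field_simp
    simp only [h2, h] at h1
    have h3 : |c⁻¹| ≠ 0 := by positivity
    exact ((smul_eq_zero.1 h1.symm).resolve_left h3)
  simp [e4]

theorem ray_cpt {n : ℕ} {c : ℝ} (hc : 0 < c) (ω : Fin n → ℝ) (F : (Fin (n + 1) → ℝ) → ℂ)
    (hFs : HasCompactSupport F) (x : Fin (n + 1) → ℝ) :
    HasCompactSupport fun s : ℝ => F (x + s • ld n c ω) := by
  have ct : Continuous fun y : Fin (n + 1) → ℝ => (y 0 - x 0) / c := by fun_prop
  refine HasCompactSupport.intro (hFs.isCompact.image ct) fun s hs => ?_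
  by_contra hne
  exact hs ⟨x + s • ld n c ω, subset_tsupport _ hne, by simp [ld]; field_simp⟩

theorem moments {n m : ℕ} {c : ℝ} (hc : 0 < c) (ω : Fin n → ℝ) (F : (Fin (n + 1) → ℝ) → ℂ)
    (hF : Continuous F) (hFs : HasCompactSupport F)
    (h : ∀ x, ∫ s : ℝ, (s : ℂ) ^ m * F (x + s • ld n c ω) = 0) (k : ℕ) (hk : k ≤ m)
    (x : Fin (n + 1) → ℝ) : ∫ s : ℝ, (s : ℂ) ^ k * F (x + s • ld n c ω) = 0 := by
  have hintg : ∀ j : ℕ, Integrable fun s : ℝ => (s : ℂ) ^ j * F (x + s • ld n c ω) := by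
    intro j
    refine Continuous.integrable_of_hasCompactSupport (by fun_prop) ?_
    exact (ray_cpt hc ω F hFs x).mul_left
  let Q : Polynomial ℂ := ∑ j ∈ range (m + 1), Polynomial.monomial (m - j)
    ((m.choose j : ℂ) * ∫ s : ℝ, (s : ℂ) ^ j * F (x + s • ld n c ω))
  have hQ : ∀ r : ℝ, Q.eval (r : ℂ) = 0 := by
    intro r
    have h1 := h (x - r • ld n c ω)
    rw [← integral_add_right_eq_self _ r] at h1
    have e : ∀ s : ℝ, ((s + r : ℝ) : ℂ) ^ m * F (x - r • ld n c ω + (s + r) • ld n c ω) =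
        ∑ j ∈ range (m + 1), ((m.choose j : ℂ) * (r : ℂ) ^ (m - j)) *
          ((s : ℂ) ^ j * F (x + s • ld n c ω)) := by
      intro s
      have : x - r • ld n c ω + (s + r) • ld n c ω = x + s • ld n c ω := by
        rw [add_smul]; abel
      rw [this]
      push_cast
      rw [add_pow, Finset.sum_mul]
      exact Finset.sum_congr rfl fun j _ => by ring
    simp only [e] at h1
    rw [integral_finsetSum _ fun j _ => (hintg j).const_mul _] at h1
    simp only [Q, Polynomial.eval_finsetSum, Polynomial.eval_monomial]
    rw [← h1]
    refine Finset.sum_congr rfl fun j _ => ?_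
    rw [integral_const_mul]; ring
  have hQ0 : Q = 0 := by
    apply Polynomial.eq_zero_of_infinite_isRoot
    refine Set.Infinite.mono ?_ ((Set.infinite_univ (α := ℝ)).image Complex.ofReal_injective.injOn)
    rintro _ ⟨r, _, rfl⟩
    exact hQ r
  have h2 := congrArg (fun p => Polynomial.coeff p (m - k)) hQ0
  simp only [Q, Polynomial.finsetSum_coeff, Polynomial.coeff_monomial, Polynomial.coeff_zero] at h2
  rw [Finset.sum_eq_single k] at h2
  · simp only [if_true] at h2
    exact (mul_eq_zero.1 h2).resolve_left (by exact_mod_cast (Nat.choose_pos hk).ne')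
  · intro j hj hne
    rw [if_neg]
    simp at hj
    omega
  · intro hne
    simp at hne
    omega

theorem weighted_zero {n m : ℕ} {c : ℝ} (hc : 0 < c) (ω : Fin n → ℝ) (F : (Fin (n + 1) → ℝ) → ℂ)
    (hF : Continuous F) (hFs : HasCompactSupport F)
    (h : ∀ x, ∫ s : ℝ, (s : ℂ) ^ m * F (x + s • ld n c ω) = 0) (k : ℕ) (hk : k ≤ m)
    (E : (Fin (n + 1) → ℝ) → ℂ) (hE : Continuous E)
    (hEi : ∀ x (s : ℝ), E (x + s • ld n c ω) = E x) :
    ∫ x, E x * (((x 0 / c : ℝ) : ℂ) ^ k * F x) = 0 := by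
  apply zero_of_rays hc ω
  · fun_prop
  · exact hFs.mul_left.mul_left
  · intro x
    have h1 := moments hc ω F hF hFs h k hk (x - (x 0 / c) • ld n c ω)
    rw [← integral_add_right_eq_self _ (x 0 / c)] at h1
    have e : ∀ s : ℝ, E (x + s • ld n c ω) * (((((x + s • ld n c ω) 0) / c : ℝ) : ℂ) ^ k *
        F (x + s • ld n c ω)) = E x * (((s + x 0 / c : ℝ) : ℂ) ^ k *
          F (x - (x 0 / c) • ld n c ω + (s + x 0 / c) • ld n c ω)) := by
      intro s
      have e1 : x - (x 0 / c) • ld n c ω + (s + x 0 / c) • ld n c ω = x + s • ld n c ω := by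
        rw [add_smul]; abel
      have e2 : ((x + s • ld n c ω) 0) / c = s + x 0 / c := by
        simp [ld]; field_simp; ring
      rw [e1, e2, hEi]
    simp only [e]
    rw [integral_const_mul, h1, mul_zero]
theorem ld_le {n : ℕ} {c : ℝ} (hc : 0 < c) {ω : Fin n → ℝ} (hω : onSphere n ω) (i : Fin (n + 1)) :
    |ld n c ω i| ≤ max c 1 := by
  refine Fin.cases ?_ (fun i => ?_) i
  · simp [ld, abs_of_pos hc]
  · simp only [ld, Fin.cons_succ]
    refine le_trans ?_ (le_max_right _ _)
    rw [← sq_le_one_iff_abs_le_one]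
    unfold onSphere at hω
    rw [← hω]
    exact Finset.single_le_sum (f := fun i => ω i ^ 2) (fun i _ => sq_nonneg _) (Finset.mem_univ i)

/-- contracted scalar function -/
def con {n m : ℕ} (c : ℝ) (f : (Fin m → Fin (n + 1)) → (Fin (n + 1) → ℝ) → ℂ) (ω : Fin n → ℝ)
    (x : Fin (n + 1) → ℝ) : ℂ :=
  ∑ i, (∏ j, (ld n c ω (i j) : ℂ)) * f i x

theorem con_cont {n m : ℕ} (c : ℝ) (f : (Fin m → Fin (n + 1)) → (Fin (n + 1) → ℝ) → ℂ)
    (hreg : IsCc n m f) (ω : Fin n → ℝ) : Continuous (con c f ω) := by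
  unfold con
  exact continuous_finsetSum _ fun i _ => continuous_const.mul (hreg i).1.continuous

theorem con_supp {n m : ℕ} (c : ℝ) (f : (Fin m → Fin (n + 1)) → (Fin (n + 1) → ℝ) → ℂ)
    (hreg : IsCc n m f) (ω : Fin n → ℝ) : HasCompactSupport (con c f ω) := by
  have : ∀ s : Finset (Fin m → Fin (n + 1)), HasCompactSupport
      (fun x => ∑ i ∈ s, (∏ j, (ld n c ω (i j) : ℂ)) * f i x) := by
    intro s
    induction s using Finset.induction_on with
    | empty =>
      simp only [Finset.sum_empty]
      exact HasCompactSupport.zero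
    | insert a s ha ih =>
      simp only [Finset.sum_insert ha]
      exact ((hreg a).2.mul_left).add ih
  exact this univ

theorem con_moment {n m : ℕ} {c : ℝ} (hc : 0 < c)
    (f : (Fin m → Fin (n + 1)) → (Fin (n + 1) → ℝ) → ℂ)
    (hreg : IsCc n m f) (ω : Fin n → ℝ) (x : Fin (n + 1) → ℝ) :
    ∫ s : ℝ, (s : ℂ) ^ m * con c f ω (x + s • ld n c ω) = mlrt n m c m f x ω := by
  unfold mlrt con
  simp only [← integral_const_mul]
  rw [← integral_finsetSum]
  · congr 1
    funext s
    rw [Finset.mul_sum]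
    exact Finset.sum_congr rfl fun i _ => by ring
  · intro i _
    have := (hreg i).1.continuous
    refine Continuous.integrable_of_hasCompactSupport (by fun_prop) ?_
    exact (ray_cpt hc ω (f i) (hreg i).2 x).mul_left.mul_left

theorem con_FT {n m : ℕ} {c : ℝ}
    (f : (Fin m → Fin (n + 1)) → (Fin (n + 1) → ℝ) → ℂ)
    (hreg : IsCc n m f) (ω : Fin n → ℝ) (ξ : Fin (n + 1) → ℝ) :
    FT (con c f ω) ξ = ∑ i, (∏ j, (ld n c ω (i j) : ℂ)) * FT (f i) ξ := by
  unfold FT con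
  simp only [← integral_const_mul]
  rw [← integral_finsetSum]
  · congr 1
    funext s
    rw [Finset.mul_sum]
    exact Finset.sum_congr rfl fun i _ => by ring
  · intro i _
    have := (hreg i).1.continuous
    have := dt_cont ξ
    refine Continuous.integrable_of_hasCompactSupport (by fun_prop) ?_
    exact (hreg i).2.mul_left.mul_left

theorem FT_bound {n m : ℕ} {c : ℝ} (hc : 0 < c)
    (f : (Fin m → Fin (n + 1)) → (Fin (n + 1) → ℝ) → ℂ)
    (hreg : IsCc n m f)
    (h : ∀ (x : Fin (n + 1) → ℝ) (ω : Fin n → ℝ), onSphere n ω → mlrt n m c m f x ω = 0)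
    (ξ : Fin (n + 1) → ℝ) :
    ∃ K : ℝ, ∀ ω, onSphere n ω → ‖FT (con c f ω) ξ‖ ≤ K * |dt ξ (ld n c ω)| ^ (m + 1) := by
  set M := max c 1 with hM
  set S := ∑ i, |ξ i| * M with hS
  have hfc : ∀ i, Continuous (f i) := fun i => (hreg i).1.continuous
  have hbint : Integrable fun x : Fin (n + 1) → ℝ =>
      |x 0 / c| ^ (m + 1) * Real.exp (S * |x 0 / c|) * (∑ i, M ^ m * ‖f i x‖) := by
    simp only [Finset.mul_sum]
    refine integrable_finsetSum _ fun i _ => ?_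
    refine Continuous.integrable_of_hasCompactSupport (by fun_prop) ?_
    exact (hreg i).2.norm.mul_left.mul_left
  refine ⟨∫ x : Fin (n + 1) → ℝ,
      |x 0 / c| ^ (m + 1) * Real.exp (S * |x 0 / c|) * (∑ i, M ^ m * ‖f i x‖), fun ω hω => ?_⟩
  set σ := dt ξ (ld n c ω) with hσ
  have hσS : |σ| ≤ S := by
    refine (Finset.abs_sum_le_sum_abs _ _).trans ?_
    refine Finset.sum_le_sum fun i _ => ?_
    rw [abs_mul]
    gcongr
    exact ld_le hc hω i
  have hFc := con_cont c f hreg ω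
  have hFs := con_supp c f hreg ω
  have hFb : ∀ x, ‖con c f ω x‖ ≤ ∑ i, M ^ m * ‖f i x‖ := by
    intro x
    refine (norm_sum_le _ _).trans (Finset.sum_le_sum fun i _ => ?_)
    rw [norm_mul, norm_prod]
    gcongr
    calc ∏ j, ‖(ld n c ω (i j) : ℂ)‖ ≤ ∏ j : Fin m, M := by
          refine Finset.prod_le_prod (fun _ _ => norm_nonneg _) fun j _ => ?_
          rw [Complex.norm_real]; exact ld_le hc hω _
      _ = M ^ m := by simp
  let E : (Fin (n + 1) → ℝ) → ℂ := fun x =>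
    Complex.exp (((σ * (x 0 / c) - dt ξ x : ℝ) : ℂ) * Complex.I)
  let z : (Fin (n + 1) → ℝ) → ℂ := fun x => -(Complex.I * (σ : ℂ)) * ((x 0 / c : ℝ) : ℂ)
  have hdc := dt_cont ξ
  have hEc : Continuous E := by fun_prop
  have hzc : Continuous z := by fun_prop
  have hEn : ∀ x, ‖E x‖ = 1 := fun x => Complex.norm_exp_ofReal_mul_I _
  have hEi : ∀ x (s : ℝ), E (x + s • ld n c ω) = E x := by
    intro x s
    simp only [E]
    congr 3
    rw [dt_add, dt_smul, ← hσ]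
    simp [ld]
    field_simp
    ring
  have hzero : ∫ x, E x * ((∑ k ∈ range (m + 1), z x ^ k / (k.factorial : ℂ)) * con c f ω x) = 0 := by
    have e : ∀ x, E x * ((∑ k ∈ range (m + 1), z x ^ k / (k.factorial : ℂ)) * con c f ω x) =
        ∑ k ∈ range (m + 1), ((-(Complex.I * (σ : ℂ))) ^ k / (k.factorial : ℂ)) *
          (E x * (((x 0 / c : ℝ) : ℂ) ^ k * con c f ω x)) := by
      intro x
      rw [Finset.sum_mul, Finset.mul_sum]
      refine Finset.sum_congr rfl fun k _ => ?_
      simp only [z, mul_pow]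
      ring
    simp only [e]
    rw [integral_finsetSum]
    · refine Finset.sum_eq_zero fun k hk => ?_
      rw [integral_const_mul, weighted_zero (m := m) hc ω _ hFc hFs
        (fun x => by rw [con_moment hc f hreg, h x ω hω]) k
        (Nat.lt_succ_iff.1 (Finset.mem_range.1 hk)) E hEc hEi, mul_zero]
    · intro k _
      refine Continuous.integrable_of_hasCompactSupport (by fun_prop) ?_
      exact hFs.mul_left.mul_left.mul_left
  have hFT : FT (con c f ω) ξ = ∫ x, E x * ((Complex.exp (z x) -
      ∑ k ∈ range (m + 1), z x ^ k / (k.factorial : ℂ)) * con c f ω x) := by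
    have e : ∀ x, E x * ((Complex.exp (z x) -
        ∑ k ∈ range (m + 1), z x ^ k / (k.factorial : ℂ)) * con c f ω x) =
        Complex.exp (-(Complex.I * (dt ξ x : ℂ))) * con c f ω x -
        E x * ((∑ k ∈ range (m + 1), z x ^ k / (k.factorial : ℂ)) * con c f ω x) := by
      intro x
      have : Complex.exp (-(Complex.I * (dt ξ x : ℂ))) = E x * Complex.exp (z x) := by
        simp only [E, z]
        rw [← Complex.exp_add]
        congr 1
        push_cast
        ring
      rw [this]; ring
    simp only [e]
    rw [integral_sub, hzero, sub_zero]
    · rfl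
    · refine Continuous.integrable_of_hasCompactSupport (by fun_prop) ?_
      exact hFs.mul_left
    · refine Continuous.integrable_of_hasCompactSupport (by fun_prop) ?_
      exact hFs.mul_left.mul_left
  rw [hFT, ← integral_mul_const]
  refine norm_integral_le_of_norm_le (hbint.mul_const _) (Filter.Eventually.of_forall fun x => ?_)
  rw [norm_mul, norm_mul, hEn, one_mul]
  have hzn : ‖z x‖ = |σ| * |x 0 / c| := by
    simp only [z]
    rw [norm_mul, norm_neg, norm_mul, Complex.norm_I, one_mul, Complex.norm_real, Complex.norm_real,
      Real.norm_eq_abs, Real.norm_eq_abs]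
  have h1 := Complex.norm_exp_sub_sum_le_norm_mul_exp (z x) (m + 1)
  rw [hzn] at h1
  calc _ ≤ ((|σ| * |x 0 / c|) ^ (m + 1) * Real.exp (|σ| * |x 0 / c|)) *
        ∑ i, M ^ m * ‖f i x‖ := by
        gcongr
        exact hFb x
    _ ≤ ((|σ| * |x 0 / c|) ^ (m + 1) * Real.exp (S * |x 0 / c|)) *
        ∑ i, M ^ m * ‖f i x‖ := by
        gcongr
    _ = _ := by rw [mul_pow]; ring

theorem con_zero {k m : ℕ} {c : ℝ} (hc : 0 < c)
    (f : (Fin m → Fin (k + 3)) → (Fin (k + 3) → ℝ) → ℂ)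
    (hreg : IsCc (k + 2) m f)
    (h : ∀ (x : Fin (k + 3) → ℝ) (ω : Fin (k + 2) → ℝ), onSphere (k + 2) ω →
      mlrt (k + 2) m c m f x ω = 0)
    (θ : Fin (k + 2) → ℝ) (hθ : onSphere (k + 2) θ) : ∀ x, con c f θ x = 0 := by
  refine FT_open _ (con_cont c f hreg θ) (con_supp c f hreg θ)
    {ξ | (c * ξ 0) ^ 2 < ξ 1 ^ 2 + ξ 2 ^ 2} (isOpen_lt (by fun_prop) (by fun_prop))
    (Fin.cons 0 fun _ => 1) ?_ ?_
  · have e1 : (1 : Fin (k + 3)) = Fin.succ 0 := rfl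
    have e2 : (2 : Fin (k + 3)) = Fin.succ 1 := rfl
    rw [Set.mem_setOf_eq, e1, e2, Fin.cons_zero, Fin.cons_succ, Fin.cons_succ]
    norm_num
  · intro ξ hξ
    obtain ⟨a, b, ha, hb, hab, h1, h2⟩ := exists_ab ξ hξ
    obtain ⟨K, hK⟩ := FT_bound hc f hreg h ξ
    rw [con_FT f hreg]
    refine conic hc (fun i => FT (f i) ξ) ξ K (fun ω hω => ?_) a b ha hb hab h1 h2 θ hθ
    have := hK ω hω
    rwa [con_FT f hreg] at this

theorem dvd_field {k m : ℕ} {c : ℝ} (hc : 0 < c)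
    (f : (Fin m → Fin (k + 3)) → (Fin (k + 3) → ℝ) → ℂ)
    (hreg : IsCc (k + 2) m f)
    (h : ∀ (x : Fin (k + 3) → ℝ) (ω : Fin (k + 2) → ℝ), onSphere (k + 2) ω →
      mlrt (k + 2) m c m f x ω = 0) (x : Fin (k + 3) → ℝ) :
    qpol (k + 2) c ∣ tpol (n := k + 2) (fun i => f i x) := by
  apply dvd_of_null (k + 1) c hc
  intro v hv0 hv
  have hl : v 0 / c ≠ 0 := div_ne_zero hv0 hc.ne'
  obtain ⟨ω, hω, -, hsum⟩ := hom_null hc (fun i => f i x) v (v 0 / c) hl (by field_simp) hv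
  have h1 := con_zero hc f hreg h ω hω x
  unfold con at h1
  rw [h1, mul_zero] at hsum
  exact (eval_tpol (n := k + 2) _ _).trans hsum

/-- If `L̃^{m,m} f` vanishes for all base points and all `ω ∈ S^{n-1}`,
then `f = 0` when `m ∈ {0,1}`, and `f = i_{g_{1/c}} f^{(m-2)}` for some smooth compactly
supported symmetric `(m-2)`-tensor field `f^{(m-2)}` when `m ≥ 2`. -/
theorem mlrt_sphere_kernel
    (n m : ℕ) (hn : 2 ≤ n) (c : ℝ) (hc : 0 < c)
    (f : (Fin m → Fin (n + 1)) → (Fin (n + 1) → ℝ) → ℂ)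
    (hsym : IsSymmF n m f) (hreg : IsCc n m f)
    (h : ∀ (x : Fin (n + 1) → ℝ) (ω : Fin n → ℝ), onSphere n ω →
      mlrt n m c m f x ω = 0) :
    (m = 0 ∨ m = 1 → ∀ i x, f i x = 0) ∧
    (∀ (m' : ℕ) (hm : m = m' + 2),
      ∃ u : (Fin m' → Fin (n + 1)) → (Fin (n + 1) → ℝ) → ℂ,
        IsSymmF n m' u ∧ IsCc n m' u ∧
        ∀ (i : Fin (m' + 2) → Fin (n + 1)) (x : Fin (n + 1) → ℝ),
          f (fun j => i (Fin.cast hm j)) x = iOpF n m' (gmet n c) u i x) := by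
  obtain ⟨k, rfl⟩ : ∃ k, n = k + 2 := ⟨n - 2, by omega⟩
  have hts : ∀ x, TSym (n := k + 2) (fun i => f i x) := fun x σ i => congrFun (hsym σ i) x
  constructor
  · intro hm i x
    have hm2 : m < 2 := by omega
    exact congrFun (null_small (hts x) hm2 (dvd_field hc f hreg h x)) i
  · intro m' hm
    subst hm
    exact exists_field (gmet (k + 2) c) f hreg
      fun x => null_large (hts x) (dvd_field hc f hreg h x)
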